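/- arXiv:2106.02126 — 4 statements merged into one kernel-verified Lean document; each statement's English description precedes it below -/
import Mathlib

section
/- For every ρ > 0 and every θ ≥ 0, the equation 1/√(1−λ) − 1/√λ = √(θ/ρ) has a unique solution λ in the interval (0,1); this solution lies in [1/2, 1) and is given in closed form by λ*_ρ(θ) = 1/2 + √(1/4 − 1/(1 + √(1 + θ/ρ))²). -/
/-- The closed-form expression `λ*_ρ(θ) = 1/2 + √(1/4 - 1/(1 + √(1 + θ/ρ))²)`. -/
noncomputable def lambdaStar (ρ θ : ℝ) : ℝ :=
  1 / 2 + Real.sqrt (1 / 4 - 1 / (1 + Real.sqrt (1 + θ / ρ)) ^ 2)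

/-- For every `ρ > 0` and `θ ≥ 0`, the equation `1/√(1-λ) - 1/√λ = √(θ/ρ)` has a unique
solution `λ` in `(0,1)`; this solution lies in `[1/2, 1)` and is given in closed form by
`λ*_ρ(θ) = 1/2 + √(1/4 - 1/(1 + √(1 + θ/ρ))²)`. -/
theorem lambdaStar_unique_solution (ρ θ : ℝ) (hρ : 0 < ρ) (hθ : 0 ≤ θ) :
    lambdaStar ρ θ ∈ Set.Ico (1 / 2 : ℝ) 1 ∧
    1 / Real.sqrt (1 - lambdaStar ρ θ) - 1 / Real.sqrt (lambdaStar ρ θ) = Real.sqrt (θ / ρ) ∧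
    ∀ lam ∈ Set.Ioo (0 : ℝ) 1,
      1 / Real.sqrt (1 - lam) - 1 / Real.sqrt lam = Real.sqrt (θ / ρ) →
        lam = lambdaStar ρ θ := by
  have ht : 0 ≤ θ / ρ := div_nonneg hθ hρ.le
  unfold lambdaStar
  generalize θ / ρ = t at ht
  have hr2 : Real.sqrt (1 + t) ^ 2 = 1 + t := Real.sq_sqrt (by linarith)
  have hr0 : 0 ≤ Real.sqrt (1 + t) := Real.sqrt_nonneg _
  generalize Real.sqrt (1 + t) = r at hr2 hr0
  have hr1 : 1 ≤ r := by nlinarith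
  have hp0 : 0 < 1 / (1 + r) := by positivity
  have hpr : 1 / (1 + r) * (1 + r) = 1 := by field_simp
  have hpe : 1 / (1 + r) ^ 2 = (1 / (1 + r)) ^ 2 := by field_simp
  rw [hpe]
  generalize 1 / (1 + r) = p at hp0 hpr
  have hp2 : p ≤ 1 / 2 := by nlinarith
  have hD : 0 ≤ 1 / 4 - p ^ 2 := by nlinarith
  have hd2 := Real.sq_sqrt hD
  have hd0 := Real.sqrt_nonneg (1 / 4 - p ^ 2)
  refine ⟨⟨by linarith, by nlinarith⟩, ?_, ?_⟩
  · generalize Real.sqrt (1 / 4 - p ^ 2) = d at hd2 hd0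
    have hd1 : d < 1 / 2 := by nlinarith
    have ha := Real.sq_sqrt (show 0 ≤ 1 / 2 + d by linarith)
    have hb := Real.sq_sqrt (show 0 ≤ 1 - (1 / 2 + d) by linarith)
    have ha0 := Real.sqrt_pos.2 (show 0 < 1 / 2 + d by linarith)
    have hb0 := Real.sqrt_pos.2 (show 0 < 1 - (1 / 2 + d) by linarith)
    have hba := Real.sqrt_le_sqrt (show 1 - (1 / 2 + d) ≤ 1 / 2 + d by linarith)
    generalize Real.sqrt (1 / 2 + d) = a at *
    generalize Real.sqrt (1 - (1 / 2 + d)) = b at *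
    have hab : a * b = p := by
      have h : (a * b) ^ 2 = p ^ 2 := by rw [mul_pow, ha, hb]; linarith
      exact (pow_left_inj₀ (by positivity) hp0.le two_ne_zero).1 h
    symm
    rw [Real.sqrt_eq_iff_eq_sq ht (sub_nonneg.2 (one_div_le_one_div_of_le hb0 hba))]
    have e : 1 / b - 1 / a = (a - b) * (1 + r) := by
      rw [← hab] at hpr
      field_simp
      linear_combination (-(a - b)) * hpr
    rw [e]
    have h1 : (a - b) ^ 2 = 1 - 2 * p := by rw [← hab]; linear_combination ha + hb
    rw [mul_pow, h1]
    linear_combination -hr2 + 2 * (1 + r) * hpr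
  · rintro l ⟨h0, h1⟩ h
    have ha := Real.sq_sqrt h0.le
    have hb := Real.sq_sqrt (show 0 ≤ 1 - l by linarith)
    have ha0 := Real.sqrt_pos.2 h0
    have hb0 := Real.sqrt_pos.2 (show 0 < 1 - l by linarith)
    have hs := Real.sq_sqrt ht
    have hs0 := Real.sqrt_nonneg t
    generalize Real.sqrt l = a at *
    generalize Real.sqrt (1 - l) = b at *
    generalize Real.sqrt t = s at *
    have h2 : a - b = s * (a * b) := by
      field_simp at h
      linarith
    have hab0 : 0 < a * b := by positivity
    have hba : b ≤ a := by nlinarith [mul_nonneg hs0 hab0.le]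
    have h3 : (r * (a * b)) ^ 2 = (1 - a * b) ^ 2 := by
      have h4 : (a - b) ^ 2 = t * (a * b) ^ 2 := by rw [h2, mul_pow, hs]
      linear_combination (a * b) ^ 2 * hr2 - h4 + ha + hb
    have h5 : a * b ≤ 1 := by nlinarith [sq_nonneg (a - b)]
    have h6 : r * (a * b) = 1 - a * b :=
      (pow_left_inj₀ (by positivity) (by linarith) two_ne_zero).1 h3
    have hab : a * b = p := by
      linear_combination p * h6 - (a * b) * hpr
    have hl : 1 / 2 ≤ l := by nlinarith
    have h7 : Real.sqrt (1 / 4 - p ^ 2) = l - 1 / 2 := by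
      rw [Real.sqrt_eq_iff_eq_sq hD (by linarith), ← hab, mul_pow, ha, hb]
      ring
    rw [h7]
    ring
end

section
/- Consider the ℕ-valued Markov process (N₁(t))_{t≥0} with N₁(0) = 0 in which, conditionally on the history up to time t, N₁(t+1) = N₁(t) + 1 with probability (t − N₁(t) + 1)/(t + 2) and N₁(t+1) = N₁(t) otherwise. Then N₁(n)/n converges to 1/2 in probability as n → ∞: for every ε > 0, P(|N₁(n)/n − 1/2| ≥ ε) → 0. -/
open MeasureTheory Filter

lemma ts_split {Ω : Type*} [MeasurableSpace Ω] (P : Measure Ω) {ι : Type*} [Countable ι]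
    [MeasurableSpace ι] [MeasurableSingletonClass ι]
    (H : Ω → ι) (hH : Measurable H) (A : Set Ω) (hA : MeasurableSet A) :
    P A = ∑' h, P (A ∩ H ⁻¹' {h}) := by
  rw [← measure_iUnion]
  · congr 1
    ext ω
    simp
  · intro i j hij
    refine Set.disjoint_left.2 ?_
    rintro ω ⟨_, h1⟩ ⟨_, h2⟩
    exact hij (h1.symm.trans h2)
  · intro i
    exact hA.inter (hH (measurableSet_singleton i))

lemma ts_step
    {Ω : Type*} [MeasurableSpace Ω] (P : Measure Ω)
    (N : ℕ → Ω → ℕ)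
    (hmeas : ∀ t, Measurable (N t))
    (hup : ∀ (t : ℕ) (m : ℕ → ℕ),
      P {ω | N (t + 1) ω = m t + 1 ∧ ∀ s ≤ t, N s ω = m s}
        = ENNReal.ofReal (((t : ℝ) - m t + 1) / ((t : ℝ) + 2))
            * P {ω | ∀ s ≤ t, N s ω = m s}) (t k : ℕ) :
    P {ω | N t ω = k ∧ N (t + 1) ω = k + 1} =
      ENNReal.ofReal (((t : ℝ) - k + 1) / ((t : ℝ) + 2)) * P {ω | N t ω = k} := by
  have hH : Measurable (fun ω (i : Fin (t + 1)) => N i ω) :=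
    measurable_pi_lambda _ fun i => hmeas _
  have hB : MeasurableSet {ω | N t ω = k} := hmeas t (measurableSet_singleton k)
  have hA : MeasurableSet {ω | N t ω = k ∧ N (t + 1) ω = k + 1} :=
    hB.inter (hmeas (t + 1) (measurableSet_singleton (k + 1)))
  rw [ts_split P _ hH _ hA, ts_split P _ hH _ hB, ← ENNReal.tsum_mul_left]
  congr 1
  ext h
  by_cases hk : h (Fin.last t) = k
  · have key := hup t (fun s => if hs : s < t + 1 then h ⟨s, hs⟩ else 0)
    have hk' : h ⟨t, Nat.lt_succ_self t⟩ = k := hk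
    simp only [Nat.lt_succ_self, dif_pos, hk'] at key
    have e : ∀ ω, (∀ s ≤ t, N s ω = if hs : s < t + 1 then h ⟨s, hs⟩ else 0) ↔
        (fun (i : Fin (t + 1)) => N i ω) = h := by
      intro ω
      constructor
      · intro H
        funext i
        have := H i (Nat.lt_succ_iff.1 i.2)
        rw [this, dif_pos i.2]
      · rintro rfl s hs
        simp [Nat.lt_succ_of_le hs]
    simp only [e] at key
    have e1 : {ω | N t ω = k ∧ N (t + 1) ω = k + 1} ∩
        (fun ω (i : Fin (t + 1)) => N i ω) ⁻¹' {h} =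
        {ω | N (t + 1) ω = k + 1 ∧ (fun (i : Fin (t + 1)) => N i ω) = h} := by
      ext ω
      constructor
      · rintro ⟨⟨a, b⟩, c⟩
        exact ⟨b, c⟩
      · rintro ⟨b, c⟩
        exact ⟨⟨(congrFun c (Fin.last t)).trans hk, b⟩, c⟩
    have e2 : {ω | N t ω = k} ∩ (fun ω (i : Fin (t + 1)) => N i ω) ⁻¹' {h} =
        {ω | (fun (i : Fin (t + 1)) => N i ω) = h} := by
      ext ω
      constructor
      · rintro ⟨a, c⟩
        exact c
      · intro c
        exact ⟨(congrFun c (Fin.last t)).trans hk, c⟩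
    rw [e1, e2]
    exact key
  · have e2 : {ω | N t ω = k} ∩ (fun ω (i : Fin (t + 1)) => N i ω) ⁻¹' {h} = ∅ := by
      ext ω
      simp only [Set.mem_inter_iff, Set.mem_empty_iff_false, iff_false]
      rintro ⟨a, c⟩
      exact hk ((congrFun c (Fin.last t)).symm.trans a)
    have e1 : {ω | N t ω = k ∧ N (t + 1) ω = k + 1} ∩
        (fun ω (i : Fin (t + 1)) => N i ω) ⁻¹' {h} = ∅ := by
      rw [Set.eq_empty_iff_forall_notMem] at e2 ⊢
      rintro ω ⟨⟨a, b⟩, c⟩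
      exact e2 ω ⟨a, c⟩
    rw [e1, e2]
    simp

lemma ts_int {Ω : Type*} [MeasurableSpace Ω] (P : Measure Ω) [IsProbabilityMeasure P]
    (N : Ω → ℕ) (hN : Measurable N) (t : ℕ) (hle : ∀ ω, N ω ≤ t) (g : ℕ → ℝ)
    (U : Set Ω) (hU : MeasurableSet U) :
    Integrable (fun ω => U.indicator (fun ω => g (N ω)) ω) P ∧
    ∫ ω, U.indicator (fun ω => g (N ω)) ω ∂P =
      ∑ k ∈ Finset.range (t + 1), g k * P.real ({ω | N ω = k} ∩ U) := by
  have hm : ∀ k, MeasurableSet ({ω | N ω = k} ∩ U) := fun k =>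
    (hN (measurableSet_singleton k)).inter hU
  have e : (fun ω => U.indicator (fun ω => g (N ω)) ω) =
      fun ω => ∑ k ∈ Finset.range (t + 1), ({ω | N ω = k} ∩ U).indicator (fun _ => g k) ω := by
    funext ω
    by_cases h : ω ∈ U
    · simp [Set.indicator, h, Nat.lt_succ_of_le (hle ω)]
    · simp [Set.indicator, h]
  have hi : ∀ k ∈ Finset.range (t + 1),
      Integrable (({ω | N ω = k} ∩ U).indicator (fun _ => g k)) P :=
    fun k _ => (integrable_const _).indicator (hm k)
  rw [e]
  refine ⟨integrable_finsetSum _ hi, ?_⟩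
  rw [integral_finsetSum _ hi]
  refine Finset.sum_congr rfl fun k _ => ?_
  rw [integral_indicator_const _ (hm k), smul_eq_mul, mul_comm]

theorem thompson_zero_reward_sampling_rate
    {Ω : Type*} [MeasurableSpace Ω] (P : Measure Ω) [IsProbabilityMeasure P]
    (N : ℕ → Ω → ℕ)
    (hmeas : ∀ t, Measurable (N t))
    (h0 : ∀ ω, N 0 ω = 0)
    (hstep : ∀ t ω, N (t + 1) ω = N t ω ∨ N (t + 1) ω = N t ω + 1)
    (hup : ∀ (t : ℕ) (m : ℕ → ℕ),
      P {ω | N (t + 1) ω = m t + 1 ∧ ∀ s ≤ t, N s ω = m s}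
        = ENNReal.ofReal (((t : ℝ) - m t + 1) / ((t : ℝ) + 2))
            * P {ω | ∀ s ≤ t, N s ω = m s}) :
    ∀ ε > 0, Tendsto (fun n => P {ω | ε ≤ |(N n ω : ℝ) / n - 1 / 2|}) atTop (nhds 0) := by
  have hle : ∀ t ω, N t ω ≤ t := by
    intro t ω
    induction t with
    | zero => simp [h0]
    | succ t ih => rcases hstep t ω with h | h <;> omega
  have hint : ∀ t (g : ℕ → ℝ), Integrable (fun ω => g (N t ω)) P := by
    intro t g
    simpa using (ts_int P (N t) (hmeas t) t (hle t) g Set.univ MeasurableSet.univ).1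
  have hsum : ∀ t (g : ℕ → ℝ), ∫ ω, g (N t ω) ∂P =
      ∑ k ∈ Finset.range (t + 1), g k * P.real {ω | N t ω = k} := by
    intro t g
    simpa using (ts_int P (N t) (hmeas t) t (hle t) g Set.univ MeasurableSet.univ).2
  have hU : ∀ t, MeasurableSet {ω | N (t + 1) ω = N t ω + 1} := fun t =>
    measurableSet_eq_fun (hmeas (t + 1)) ((hmeas t).add_const 1)
  have hupint : ∀ t (g : ℕ → ℝ),
      ∫ ω, {ω | N (t + 1) ω = N t ω + 1}.indicator (fun ω => g (N t ω)) ω ∂P =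
      ∫ ω, g (N t ω) * (((t : ℝ) - N t ω + 1) / ((t : ℝ) + 2)) ∂P := by
    intro t g
    rw [(ts_int P (N t) (hmeas t) t (hle t) g _ (hU t)).2,
      hsum t (fun k => g k * (((t : ℝ) - k + 1) / ((t : ℝ) + 2)))]
    refine Finset.sum_congr rfl fun k hk => ?_
    have hk' : (k : ℝ) ≤ t := by
      exact_mod_cast Nat.lt_succ_iff.1 (Finset.mem_range.1 hk)
    have e : {ω | N t ω = k} ∩ {ω | N (t + 1) ω = N t ω + 1} =
        {ω | N t ω = k ∧ N (t + 1) ω = k + 1} := by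
      ext ω
      constructor
      · rintro ⟨a, b⟩
        simp only [Set.mem_ofPred_eq] at a b ⊢
        exact ⟨a, by rw [b, a]⟩
      · rintro ⟨a, b⟩
        exact ⟨a, by simp only [Set.mem_ofPred_eq]; rw [a, b]⟩
    rw [e, Measure.real, ts_step P N hmeas hup t k, ENNReal.toReal_mul,
      ENNReal.toReal_ofReal (div_nonneg (by linarith) (by positivity)), mul_assoc]
    rfl
  have hrec : ∀ t : ℕ, ∫ ω, (2 * (N t ω : ℝ) - t) ^ 2 ∂P ≤ (t : ℝ) := by
    intro t
    induction t with
    | zero => simp [h0]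
    | succ t ih =>
      have e : ∀ ω, (2 * (N (t + 1) ω : ℝ) - (t + 1 : ℕ)) ^ 2 =
          ((2 * (N t ω : ℝ) - t) ^ 2 + 1 - 2 * (2 * (N t ω : ℝ) - t)) +
          {ω | N (t + 1) ω = N t ω + 1}.indicator
            (fun ω => 4 * (2 * (N t ω : ℝ) - t)) ω := by
        intro ω
        rcases hstep t ω with h | h
        · simp [Set.indicator, h]
          ring
        · simp [Set.indicator, h]
          ring
      simp_rw [e]
      rw [integral_add (hint t fun k => (2 * (k : ℝ) - t) ^ 2 + 1 - 2 * (2 * (k : ℝ) - t))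
        (ts_int P (N t) (hmeas t) t (hle t) (fun k => 4 * (2 * (k : ℝ) - t)) _ (hU t)).1,
        hupint t (fun k => 4 * (2 * (k : ℝ) - t)),
        ← integral_add (hint t fun k => (2 * (k : ℝ) - t) ^ 2 + 1 - 2 * (2 * (k : ℝ) - t))
          (hint t fun k => 4 * (2 * (k : ℝ) - t) * (((t : ℝ) - k + 1) / ((t : ℝ) + 2)))]
      calc _ ≤ ∫ ω, ((2 * (N t ω : ℝ) - t) ^ 2 + 1) ∂P := by
            refine integral_mono
              (hint t fun k => ((2 * (k : ℝ) - t) ^ 2 + 1 - 2 * (2 * (k : ℝ) - t)) +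
                4 * (2 * (k : ℝ) - t) * (((t : ℝ) - k + 1) / ((t : ℝ) + 2)))
              (hint t fun k => (2 * (k : ℝ) - t) ^ 2 + 1) ?_
            intro ω
            have h2 : (0 : ℝ) < t + 2 := by positivity
            have : ((2 * (N t ω : ℝ) - t) ^ 2 + 1 - 2 * (2 * (N t ω : ℝ) - t)) +
                4 * (2 * (N t ω : ℝ) - t) * (((t : ℝ) - N t ω + 1) / ((t : ℝ) + 2)) =
                ((2 * (N t ω : ℝ) - t) ^ 2 + 1) - 2 * (2 * (N t ω : ℝ) - t) ^ 2 / (t + 2) := by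
              field_simp
              ring
            simp only [this]
            have : 0 ≤ 2 * (2 * (N t ω : ℝ) - t) ^ 2 / (t + 2) := by positivity
            linarith
        _ ≤ _ := by
            rw [integral_add (hint t fun k => (2 * (k : ℝ) - t) ^ 2) (integrable_const _)]
            simp
            exact ih
  intro ε hε
  have hbound : ∀ᶠ n : ℕ in atTop, P {ω | ε ≤ |(N n ω : ℝ) / n - 1 / 2|} ≤
      ENNReal.ofReal ((1 / (4 * ε ^ 2)) * (1 / (n : ℝ))) := by
    filter_upwards [eventually_gt_atTop 0] with n hn
    have hn' : (0 : ℝ) < n := by exact_mod_cast hn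
    have hM := mul_meas_ge_le_integral_of_nonneg (μ := P)
      (f := fun ω => (2 * (N n ω : ℝ) - n) ^ 2)
      (Eventually.of_forall fun ω => sq_nonneg _)
      (hint n fun k => (2 * (k : ℝ) - n) ^ 2) (4 * ε ^ 2 * n ^ 2)
    have hM2 := hM.trans (hrec n)
    have hsub : {ω | ε ≤ |(N n ω : ℝ) / n - 1 / 2|} ⊆
        {ω | 4 * ε ^ 2 * (n : ℝ) ^ 2 ≤ (2 * (N n ω : ℝ) - n) ^ 2} := by
      intro ω h
      simp only [Set.mem_ofPred_eq] at h ⊢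
      have h1 : ε ^ 2 ≤ ((N n ω : ℝ) / n - 1 / 2) ^ 2 := by
        rw [← sq_abs ((N n ω : ℝ) / n - 1 / 2)]
        gcongr
      have h2 : (2 * (N n ω : ℝ) - n) ^ 2 = 4 * ((N n ω : ℝ) / n - 1 / 2) ^ 2 * n ^ 2 := by
        field_simp
        ring
      rw [h2]
      gcongr
    refine (measure_mono hsub).trans ?_
    rw [← ENNReal.ofReal_toReal (measure_ne_top P _)]
    apply ENNReal.ofReal_le_ofReal
    have : (1 / (4 * ε ^ 2)) * (1 / (n : ℝ)) = n / (4 * ε ^ 2 * n ^ 2) := by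
      field_simp
    rw [this, le_div_iff₀ (by positivity), mul_comm]
    exact hM2
  refine tendsto_of_tendsto_of_tendsto_of_le_of_le' tendsto_const_nhds ?_
    (Eventually.of_forall fun _ => zero_le) hbound
  have : Tendsto (fun n : ℕ => (1 / (4 * ε ^ 2)) * (1 / (n : ℝ))) atTop (nhds 0) := by
    have h := (tendsto_one_div_atTop_nhds_zero_nat (𝕜 := ℝ)).const_mul (1 / (4 * ε ^ 2))
    rwa [mul_zero] at h
  simpa using ENNReal.tendsto_ofReal this
end

section
/- Fix θ ≥ 0 and ρ > 0, and define f : (0,1) → ℝ by f(x) = √x − √(1−x) − √(θ/ρ)·√(x(1−x)). Then f is strictly monotone increasing on the interval (1/2, 1); moreover, f(λ*_ρ(θ)) = 0 where λ*_ρ(θ) ∈ [1/2,1) is the unique solution of 1/√(1−λ) − 1/√λ = √(θ/ρ), and f(x) > 0 for every x ∈ (λ*_ρ(θ), 1). -/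
theorem ucb_aux_lt (c x y : ℝ) (hc : 0 ≤ c) (hx : 1 / 2 ≤ x) (hxy : x < y) (hy : y < 1) :
    Real.sqrt x - Real.sqrt (1 - x) - c * Real.sqrt (x * (1 - x)) <
      Real.sqrt y - Real.sqrt (1 - y) - c * Real.sqrt (y * (1 - y)) := by
  have h1 : Real.sqrt x < Real.sqrt y := Real.sqrt_lt_sqrt (by linarith) hxy
  have h2 : Real.sqrt (1 - y) < Real.sqrt (1 - x) :=
    Real.sqrt_lt_sqrt (by linarith) (by linarith)
  have h3 : Real.sqrt (y * (1 - y)) ≤ Real.sqrt (x * (1 - x)) :=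
    Real.sqrt_le_sqrt (by nlinarith)
  have h4 := mul_le_mul_of_nonneg_left h3 hc
  linarith

/-- Fix `θ ≥ 0` and `ρ > 0`, and let `f(x) = √x - √(1-x) - √(θ/ρ)·√(x(1-x))`.  Then `f` is
strictly monotone increasing on `(1/2, 1)`; moreover `f(λ*_ρ(θ)) = 0`, where `λ*_ρ(θ)` is the
unique solution `λ ∈ [1/2, 1)` of `1/√(1-λ) - 1/√λ = √(θ/ρ)`, and `f(x) > 0` for every
`x ∈ (λ*_ρ(θ), 1)`. -/
theorem ucb_moderate_gap_f_properties (ρ θ : ℝ) (hρ : 0 < ρ) (hθ : 0 ≤ θ) :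
    StrictMonoOn
      (fun x : ℝ => Real.sqrt x - Real.sqrt (1 - x)
        - Real.sqrt (θ / ρ) * Real.sqrt (x * (1 - x)))
      (Set.Ioo (1 / 2 : ℝ) 1) ∧
    ∀ lam : ℝ, lam ∈ Set.Ico (1 / 2 : ℝ) 1 →
      1 / Real.sqrt (1 - lam) - 1 / Real.sqrt lam = Real.sqrt (θ / ρ) →
      (Real.sqrt lam - Real.sqrt (1 - lam)
          - Real.sqrt (θ / ρ) * Real.sqrt (lam * (1 - lam)) = 0 ∧
        ∀ x ∈ Set.Ioo lam 1,
          0 < Real.sqrt x - Real.sqrt (1 - x)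
              - Real.sqrt (θ / ρ) * Real.sqrt (x * (1 - x))) := by
  have hc := Real.sqrt_nonneg (θ / ρ)
  refine ⟨fun x hx y hy hxy => ucb_aux_lt _ x y hc hx.1.le hxy hy.2, ?_⟩
  intro lam hl heq
  have h0 : Real.sqrt lam - Real.sqrt (1 - lam)
      - Real.sqrt (θ / ρ) * Real.sqrt (lam * (1 - lam)) = 0 := by
    have hl1 := hl.1
    have hl2 := hl.2
    have ha : 0 < Real.sqrt lam := Real.sqrt_pos.2 (by linarith)
    have hb : 0 < Real.sqrt (1 - lam) := Real.sqrt_pos.2 (by linarith)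
    rw [← heq, Real.sqrt_mul (by linarith)]
    field_simp
    ring
  refine ⟨h0, fun x hx => ?_⟩
  have := ucb_aux_lt _ lam x hc hl.1 hx.1 hx.2
  linarith
end

section
/- Fix an integer L ≥ 2 and define f(ε, L) := √( (L−1)(1 + εL)(L−1 − εL) / (2(L−1) + L(L−2)ε)² ) for ε ∈ [0, (L−1)/L]. Then ε ↦ f(ε, L) is monotone decreasing on [0, (L−1)/L], f(0, L) = 1/2, f((L−1)/L, L) = 0, and 1 − 2f(ε, L) > 0 for every ε ∈ (0, (L−1)/L]. Moreover, for any positive integers m_i, m_j with m_i/(m_i + m_j) ≥ (1/L + ε)/(2/L + (L−2)ε/(L−1)) and ε ∈ (0, (L−1)/L), it holds that m_i·m_j/(m_i + m_j)² ≤ f(ε, L)² < 1/4. -/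
/-- `f(ε, L) = √((L-1)(1 + εL)(L-1 - εL) / (2(L-1) + L(L-2)ε)²)`. -/
noncomputable def balanceF (ε : ℝ) (L : ℕ) : ℝ :=
  Real.sqrt (((L : ℝ) - 1) * (1 + ε * L) * ((L : ℝ) - 1 - ε * L)
    / (2 * ((L : ℝ) - 1) + L * ((L : ℝ) - 2) * ε) ^ 2)

/-- Auxiliary deviation `p - 1/2`. -/
noncomputable def balG (ε l : ℝ) : ℝ := l * l * ε / (2 * (2 * (l - 1) + l * (l - 2) * ε))

lemma balD_pos {ε l : ℝ} (hl : 2 ≤ l) (h0 : 0 ≤ ε) : 0 < 2 * (l - 1) + l * (l - 2) * ε := by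
  have : 0 ≤ l * (l - 2) * ε := mul_nonneg (mul_nonneg (by linarith) (by linarith)) h0
  linarith

lemma balKey {ε l : ℝ} (hl : 2 ≤ l) (h0 : 0 ≤ ε) :
    (l - 1) * (1 + ε * l) * (l - 1 - ε * l) / (2 * (l - 1) + l * (l - 2) * ε) ^ 2
      = 1 / 4 - balG ε l ^ 2 := by
  have hD := (balD_pos hl h0).ne'
  unfold balG
  generalize hd : 2 * (l - 1) + l * (l - 2) * ε = d at *
  field_simp
  rw [← hd]
  ring

lemma balG_nonneg {ε l : ℝ} (hl : 2 ≤ l) (h0 : 0 ≤ ε) : 0 ≤ balG ε l := by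
  have hD := balD_pos hl h0
  have : 0 ≤ l := by linarith
  unfold balG
  positivity

lemma balG_pos {ε l : ℝ} (hl : 2 ≤ l) (h0 : 0 < ε) : 0 < balG ε l := by
  have hD := balD_pos hl h0.le
  have : 0 < l := by linarith
  unfold balG
  positivity

lemma balG_mono {a b l : ℝ} (hl : 2 ≤ l) (h0 : 0 ≤ a) (hab : a ≤ b) : balG a l ≤ balG b l := by
  have hA := balD_pos hl h0
  have hB := balD_pos hl (h0.trans hab)
  unfold balG
  rw [div_le_div_iff₀ (by linarith) (by linarith)]
  have : 0 ≤ (l * l * (l - 1)) * (b - a) :=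
    mul_nonneg (mul_nonneg (mul_self_nonneg l) (by linarith)) (by linarith)
  nlinarith [this]

/-- Fix an integer `L ≥ 2`.  Then `ε ↦ f(ε, L)` is monotone decreasing on `[0, (L-1)/L]`,
`f(0, L) = 1/2`, `f((L-1)/L, L) = 0`, and `1 - 2f(ε, L) > 0` for every `ε ∈ (0, (L-1)/L]`.
Moreover, for positive integers `m_i, m_j` with
`m_i/(m_i + m_j) ≥ (1/L + ε)/(2/L + (L-2)ε/(L-1))` and `ε ∈ (0, (L-1)/L)`, it holds that
`m_i·m_j/(m_i + m_j)² ≤ f(ε, L)² < 1/4`. -/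
theorem balanceF_properties (L : ℕ) (hL : 2 ≤ L) :
    AntitoneOn (fun ε => balanceF ε L) (Set.Icc (0 : ℝ) (((L : ℝ) - 1) / L)) ∧
    balanceF 0 L = 1 / 2 ∧
    balanceF (((L : ℝ) - 1) / L) L = 0 ∧
    (∀ ε ∈ Set.Ioc (0 : ℝ) (((L : ℝ) - 1) / L), 0 < 1 - 2 * balanceF ε L) ∧
    (∀ ε ∈ Set.Ioo (0 : ℝ) (((L : ℝ) - 1) / L), ∀ mi mj : ℕ, 0 < mi → 0 < mj →
      (1 / L + ε) / (2 / L + ((L : ℝ) - 2) * ε / ((L : ℝ) - 1))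
          ≤ (mi : ℝ) / ((mi : ℝ) + mj) →
      ((mi : ℝ) * mj / ((mi : ℝ) + mj) ^ 2 ≤ balanceF ε L ^ 2 ∧
        balanceF ε L ^ 2 < 1 / 4)) := by
  have hl : (2 : ℝ) ≤ L := by exact_mod_cast hL
  have hl0 : (0 : ℝ) < L := by linarith
  have key : ∀ ε : ℝ, 0 ≤ ε → balanceF ε L = Real.sqrt (1 / 4 - balG ε L ^ 2) := by
    intro ε h
    unfold balanceF
    rw [balKey hl h]
  have hnn : ∀ ε : ℝ, 0 ≤ ε → ε ≤ ((L : ℝ) - 1) / L → 0 ≤ 1 / 4 - balG ε L ^ 2 := by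
    intro ε h h1
    rw [le_div_iff₀ hl0] at h1
    rw [← balKey hl h]
    have h2 : 0 ≤ (L : ℝ) - 1 := by linarith
    have h3 : 0 ≤ (L : ℝ) - 1 - ε * L := by linarith
    positivity
  have hlt : ∀ ε : ℝ, 0 < ε → balanceF ε L < 1 / 2 := by
    intro ε h
    rw [key ε h.le, Real.sqrt_lt' (by norm_num)]
    have := balG_pos hl h
    nlinarith
  refine ⟨?_, ?_, ?_, ?_, ?_⟩
  · intro a ha b hb hab
    change balanceF b L ≤ balanceF a L
    rw [key a ha.1, key b hb.1]
    apply Real.sqrt_le_sqrt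
    have := pow_le_pow_left₀ (balG_nonneg hl ha.1) (balG_mono hl ha.1 hab) 2
    linarith
  · rw [key 0 le_rfl, Real.sqrt_eq_iff_mul_self_eq_of_pos (by norm_num)]
    norm_num [balG]
  · unfold balanceF
    rw [div_mul_cancel₀ _ hl0.ne']
    simp
  · intro ε h
    have := hlt ε h.1
    linarith
  · intro ε h mi mj hi hj hm
    have hi' : (0 : ℝ) < mi := by exact_mod_cast hi
    have hj' : (0 : ℝ) < mj := by exact_mod_cast hj
    have hsq : balanceF ε L ^ 2 = 1 / 4 - balG ε L ^ 2 := by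
      rw [key ε h.1.le, Real.sq_sqrt (hnn ε h.1.le h.2.le)]
    have hG := balG_pos hl h.1
    rw [hsq]
    refine ⟨?_, by nlinarith⟩
    have e1 : (1 / (L : ℝ) + ε) / (2 / L + ((L : ℝ) - 2) * ε / ((L : ℝ) - 1))
        = 1 / 2 + balG ε L := by
      have hD := balD_pos hl h.1.le
      have hk : (0 : ℝ) < (L : ℝ) - 1 := by linarith
      have e2 : 2 / (L : ℝ) + ((L : ℝ) - 2) * ε / ((L : ℝ) - 1)
          = (2 * ((L : ℝ) - 1) + L * ((L : ℝ) - 2) * ε) / (L * ((L : ℝ) - 1)) := by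
        field_simp
      rw [e2]
      unfold balG
      generalize hd : 2 * ((L : ℝ) - 1) + L * ((L : ℝ) - 2) * ε = d at *
      field_simp
      rw [← hd]
      ring
    rw [e1] at hm
    have e3 : (mi : ℝ) * mj / ((mi : ℝ) + mj) ^ 2
        = 1 / 4 - ((mi : ℝ) / ((mi : ℝ) + mj) - 1 / 2) ^ 2 := by
      field_simp
      ring
    rw [e3]
    have := pow_le_pow_left₀ hG.le (show balG ε L ≤ (mi : ℝ) / ((mi : ℝ) + mj) - 1 / 2 by linarith) 2
    linarith
end
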